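/- Let G be a finite multigraph and K a field of characteristic 0. The algebras B_G^{F_1} and C_G^{F_1} (the case t = 1) are isomorphic as K-algebras. -/

import Mathlib

open MvPolynomial

namespace ForestAlg

variable {V E : Type*}

/-- Two vertices are directly connected by an edge of `A`. -/
def edgeRel (ends : E → Sym2 V) (A : Finset E) (v w : V) : Prop :=
  ∃ e ∈ A, ends e = s(v, w)

/-- Number of connected components of the spanning subgraph `(V, A)`. -/
noncomputable def numComponents (ends : E → Sym2 V) (A : Finset E) : ℕ :=
  Nat.card (Quot (edgeRel ends A))

/-- Rank `r(A) = v(G) - c(V,A)`. -/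
noncomputable def rank (ends : E → Sym2 V) (A : Finset E) : ℕ :=
  Nat.card V - numComponents ends A

/-- `A` is a subforest (contains no cycle): `|A| = v(G) - c(V,A)`. -/
def IsForest (ends : E → Sym2 V) (A : Finset E) : Prop :=
  A.card + numComponents ends A = Nat.card V

/-- The Tutte polynomial, evaluated at `(x, y)`. -/
noncomputable def tutte [Fintype E] {R : Type*} [CommRing R]
    (ends : E → Sym2 V) (x y : R) : R :=
  ∑ A ∈ (Finset.univ : Finset E).powerset,
    (x - 1) ^ (rank ends Finset.univ - rank ends A) *
      (y - 1) ^ (A.card - rank ends A)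

/-- `e ∉ F` is externally active for the subforest `F` with respect to the linear
order `o`: `F + e` contains a cycle and `e` is the minimal edge of that cycle
(the edges of the unique cycle of `F + e` are those whose removal does not
decrease the rank). -/
def ExtActive [DecidableEq E] (o : LinearOrder E) (ends : E → Sym2 V)
    (F : Finset E) (e : E) : Prop :=
  e ∉ F ∧ ¬ IsForest ends (insert e F) ∧
    ∀ f ∈ insert e F,
      rank ends ((insert e F).erase f) = rank ends (insert e F) → o.le e f

/-- External activity `act_G(F)`. -/
noncomputable def act [DecidableEq E] (o : LinearOrder E) (ends : E → Sym2 V)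
    (F : Finset E) : ℕ :=
  Set.ncard {e : E | ExtActive o ends F e}

/-- `D_I`: number of edges with one endpoint in `I` and the other outside `I`. -/
noncomputable def crossCount {n : ℕ} (ends : E → Sym2 (Fin n))
    (I : Finset (Fin n)) : ℕ :=
  Set.ncard {e : E | (∃ v ∈ ends e, v ∈ I) ∧ ∃ w ∈ ends e, w ∉ I}

/-- The ideal `J_G^{F_t}` generated by `(∑_{i ∈ I} x_i)^{t·D_I + 1}` over nonempty `I`. -/
noncomputable def forestIdeal (K : Type*) [Field K] {n : ℕ} (t : ℕ)
    (ends : E → Sym2 (Fin n)) : Ideal (MvPolynomial (Fin n) K) :=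
  Ideal.span {p | ∃ I : Finset (Fin n), I.Nonempty ∧
    p = (∑ i ∈ I, X i) ^ (t * crossCount ends I + 1)}

/-- The `k`-th graded component of `K[x_1,…,x_n]/J` (for homogeneous `J`):
the image of the degree-`k` homogeneous part in the quotient. -/
noncomputable def gradedPiece (K : Type*) [Field K] {n : ℕ}
    (J : Ideal (MvPolynomial (Fin n) K)) (k : ℕ) :
    Submodule K (MvPolynomial (Fin n) K ⧸ J) :=
  Submodule.map (Ideal.Quotient.mkₐ K J).toLinearMap
    (homogeneousSubmodule (Fin n) K k)

/-- Dimension of the `k`-th graded component of the quotient. -/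
noncomputable def gradedDim (K : Type*) [Field K] {n : ℕ}
    (J : Ideal (MvPolynomial (Fin n) K)) (k : ℕ) : ℕ :=
  Module.finrank K (gradedPiece K J k)

/-- The ideal `(φ_e^{t+1} : e ∈ E)` in `K[φ_e : e ∈ E]`. -/
noncomputable def phiIdeal (K : Type*) [Field K] (E : Type*) (t : ℕ) :
    Ideal (MvPolynomial E K) :=
  Ideal.span (Set.range fun e : E => (X e : MvPolynomial E K) ^ (t + 1))

/-- The algebra `Φ_G^{F_t}` generated by commuting variables `φ_e` with relations
`φ_e^{t+1} = 0`. -/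
abbrev Phi (K : Type*) [Field K] (E : Type*) (t : ℕ) : Type _ :=
  MvPolynomial E K ⧸ phiIdeal K E t

/-- The generator `φ_e` of `Φ_G^{F_t}`. -/
noncomputable def phiVar (K : Type*) [Field K] {E : Type*} (t : ℕ) (e : E) :
    Phi K E t :=
  Ideal.Quotient.mk (phiIdeal K E t) (X e)

/-- The smaller endpoint of an edge. -/
def symInf {n : ℕ} (s : Sym2 (Fin n)) : Fin n :=
  Sym2.lift ⟨fun a b => a ⊓ b, fun a b => inf_comm a b⟩ s

/-- The larger endpoint of an edge. -/
def symSup {n : ℕ} (s : Sym2 (Fin n)) : Fin n :=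
  Sym2.lift ⟨fun a b => a ⊔ b, fun a b => sup_comm a b⟩ s

/-- The coefficient `c_{i,e}`: `+1` if `i` is the smaller endpoint of the
non-loop edge `e`, `-1` if `i` is the larger endpoint, `0` otherwise. -/
def endCoeff {n : ℕ} (ends : E → Sym2 (Fin n)) (i : Fin n) (e : E) : ℤ :=
  (if i = symInf (ends e) then 1 else 0) - (if i = symSup (ends e) then 1 else 0)

/-- The element `X_i = ∑_e c_{i,e} φ_e` of `Φ_G^{F_t}`. -/
noncomputable def Xgen (K : Type*) [Field K] [Fintype E] {n : ℕ} (t : ℕ)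
    (ends : E → Sym2 (Fin n)) (i : Fin n) : Phi K E t :=
  ∑ e : E, endCoeff ends i e • phiVar K t e

/-- The subalgebra `C_G^{F_t}` of `Φ_G^{F_t}` generated by `X_1, …, X_n`. -/
noncomputable def Csub (K : Type*) [Field K] [Fintype E] {n : ℕ} (t : ℕ)
    (ends : E → Sym2 (Fin n)) : Subalgebra K (Phi K E t) :=
  Algebra.adjoin K (Set.range (Xgen K t ends))


section CutIdeal

variable {K V E : Type*} [Field K] [DecidableEq V]

/-- The coefficient of an edge oriented from `a` to `b` at the vertex `i`. -/
def incidence (a b i : V) : ℤ :=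
  (if i = a then 1 else 0) - (if i = b then 1 else 0)

/-- The directional derivative along the incidence vector of an edge from `a` to `b`. -/
noncomputable def edgeDeriv (K : Type*) [Field K] (a b : V) :
    Derivation K (MvPolynomial V K) (MvPolynomial V K) :=
  pderiv a - pderiv b

lemma edgeDeriv_X (a b i : V) :
    edgeDeriv K a b (X i) = algebraMap ℤ (MvPolynomial V K) (incidence a b i) := by
  simp [edgeDeriv, incidence, pderiv_X, Pi.single_apply, eq_comm]

lemma edgeDeriv_sum_X (a b : V) (I : Finset V) :
    edgeDeriv K a b (∑ i ∈ I, X i) =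
      (if a ∈ I then 1 else 0) - (if b ∈ I then 1 else 0) := by
  simp [edgeDeriv_X, incidence, Finset.sum_sub_distrib]

/-- The number of edges in `S` with exactly one endpoint in `I`. -/
def cutCard (S : Finset E) (a b : E → V) (I : Finset V) : ℕ :=
  (S.filter fun e => ¬(a e ∈ I ↔ b e ∈ I)).card

/-- The ideal generated by the powers of the cut forms of the graph with edge set `S`. -/
noncomputable def cutIdeal (K : Type*) [Field K] (S : Finset E) (a b : E → V) :
    Ideal (MvPolynomial V K) :=
  Ideal.span {p | ∃ I : Finset V, I.Nonempty ∧ p = (∑ i ∈ I, X i) ^ (cutCard S a b I + 1)}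

/-- The signed sum at `i` of the generators `φ_e` over the edges in `S`. -/
noncomputable def vertexSum (K : Type*) [Field K] (S : Finset E) (a b : E → V) (i : V) :
    Phi K E 1 :=
  ∑ e ∈ S, incidence (a e) (b e) i • phiVar K 1 e

lemma cutCard_insert_of_not [DecidableEq E] {S : Finset E} {e : E} (he : e ∉ S) {a b : E → V}
    {I : Finset V} (h : ¬(a e ∈ I ↔ b e ∈ I)) :
    cutCard (insert e S) a b I = cutCard S a b I + 1 := by
  rw [cutCard, Finset.filter_insert, if_pos h, Finset.card_insert_of_notMem (by simp [he])]
  rfl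

lemma cutCard_insert_of_iff [DecidableEq E] {S : Finset E} {e : E} {a b : E → V}
    {I : Finset V} (h : a e ∈ I ↔ b e ∈ I) :
    cutCard (insert e S) a b I = cutCard S a b I := by
  rw [cutCard, Finset.filter_insert, if_neg (not_not.2 h)]
  rfl

lemma phiVar_sq (e : E) : phiVar K 1 e ^ 2 = 0 := by
  rw [phiVar, ← map_pow, Ideal.Quotient.eq_zero_iff_mem]
  exact Ideal.subset_span ⟨e, rfl⟩

lemma sum_smul_phiVar_pow_eq_zero (T : Finset E) (c : E → ℤ) :
    (∑ e ∈ T, c e • phiVar K 1 e) ^ (T.card + 1) = 0 := by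
  classical
  induction T using Finset.induction_on with
  | empty => simp
  | insert e T he ih =>
    rw [Finset.sum_insert he, Finset.card_insert_of_notMem he]
    refine (Commute.all _ _).add_pow_eq_zero_of_add_le_succ_of_pow_eq_zero
      (m := 2) (n := T.card + 1) ?_ ih (by omega)
    rw [smul_pow, phiVar_sq, smul_zero]

lemma sum_vertexSum (S : Finset E) (a b : E → V) (I : Finset V) :
    ∑ i ∈ I, vertexSum K S a b i =
      ∑ e ∈ S, ((if a e ∈ I then 1 else 0) - (if b e ∈ I then 1 else 0) : ℤ) •
        phiVar K 1 e := by
  simp only [vertexSum]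
  rw [Finset.sum_comm]
  refine Finset.sum_congr rfl fun e _ => ?_
  rw [← Finset.sum_smul]
  simp [incidence, Finset.sum_sub_distrib]

lemma sum_vertexSum_pow_eq_zero (S : Finset E) (a b : E → V) (I : Finset V) :
    (∑ i ∈ I, vertexSum K S a b i) ^ (cutCard S a b I + 1) = 0 := by
  rw [sum_vertexSum, cutCard,
    ← Finset.sum_filter_of_ne (p := fun e => ¬(a e ∈ I ↔ b e ∈ I))]
  · exact sum_smul_phiVar_pow_eq_zero _ _
  · intro e _ h hiff
    simp [hiff] at h

lemma aeval_vertexSum_eq_zero_of_mem {S : Finset E} {a b : E → V} {p : MvPolynomial V K}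
    (hp : p ∈ cutIdeal K S a b) : aeval (vertexSum K S a b) p = 0 := by
  suffices cutIdeal K S a b ≤ RingHom.ker (aeval (vertexSum K S a b) :
      MvPolynomial V K →ₐ[K] Phi K E 1) from this hp
  rw [cutIdeal, Ideal.span_le]
  rintro _ ⟨I, _, rfl⟩
  simp [RingHom.mem_ker, sum_vertexSum_pow_eq_zero]

section DualNumbers

open scoped DualNumber

/-- First-order Taylor expansion of a polynomial over the dual numbers. -/
lemma aeval_dualNumber {R : Type*} [CommRing R] [Algebra K R] (a b : V) (x : V → R)
    (p : MvPolynomial V K) :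
    aeval (fun i => TrivSqZeroExt.inl (x i) + incidence a b i • (DualNumber.eps : R[ε])) p =
      TrivSqZeroExt.inl (aeval x p) + TrivSqZeroExt.inr (aeval x (edgeDeriv K a b p)) := by
  induction p using MvPolynomial.induction_on with
  | C r => simp [edgeDeriv]; rfl
  | add p q hp hq =>
    simp only [map_add, hp, hq, TrivSqZeroExt.inl_add, TrivSqZeroExt.inr_add]
    abel
  | mul_X p i hp =>
    rw [map_mul, hp, aeval_X, Derivation.leibniz, edgeDeriv_X]
    ext
    · simp
    · simp
      ring

/-- The homomorphism sending `φ_e` to `ε` and fixing the other generators. -/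
noncomputable def phiDual [DecidableEq E] (K : Type*) [Field K] (e : E) :
    Phi K E 1 →ₐ[K] (Phi K E 1)[ε] :=
  Ideal.Quotient.liftₐ _
    (aeval fun f => if f = e then DualNumber.eps else TrivSqZeroExt.inl (phiVar K 1 f)) (by
      suffices phiIdeal K E 1 ≤ RingHom.ker (aeval fun f =>
          if f = e then (DualNumber.eps : (Phi K E 1)[ε])
          else TrivSqZeroExt.inl (phiVar K 1 f)) from fun p hp => RingHom.mem_ker.1 (this hp)
      refine Ideal.span_le.2 ?_
      rintro _ ⟨f, rfl⟩
      by_cases h : f = e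
      · simp [RingHom.mem_ker, h, pow_two]
      · simp only [SetLike.mem_coe, RingHom.mem_ker, map_pow, aeval_X, if_neg h]
        rw [TrivSqZeroExt.inl_pow, phiVar_sq, TrivSqZeroExt.inl_zero])

lemma phiDual_phiVar [DecidableEq E] (e f : E) :
    phiDual K e (phiVar K 1 f) =
      if f = e then DualNumber.eps else TrivSqZeroExt.inl (phiVar K 1 f) := by
  exact aeval_X (fun f => if f = e then DualNumber.eps else
    TrivSqZeroExt.inl (phiVar K 1 f)) f

lemma phiDual_vertexSum [DecidableEq E] {S : Finset E} {e : E} (he : e ∉ S) (a b : E → V)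
    (i : V) :
    phiDual K e (vertexSum K (insert e S) a b i) =
      TrivSqZeroExt.inl (vertexSum K S a b i) + incidence (a e) (b e) i • DualNumber.eps := by
  rw [vertexSum, Finset.sum_insert he, map_add, map_zsmul, phiDual_phiVar, if_pos rfl,
    add_comm, vertexSum, map_sum]
  congr 1
  rw [← TrivSqZeroExt.inlHom_apply, map_sum]
  refine Finset.sum_congr rfl fun f hf => ?_
  rw [map_zsmul, map_zsmul, phiDual_phiVar, if_neg (ne_of_mem_of_not_mem hf he)]
  rfl

lemma aeval_vertexSum_insert_eq_zero [DecidableEq E] {S : Finset E} {e : E} (he : e ∉ S)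
    {a b : E → V} {p : MvPolynomial V K}
    (hp : aeval (vertexSum K (insert e S) a b) p = 0) :
    aeval (vertexSum K S a b) p = 0 ∧
      aeval (vertexSum K S a b) (edgeDeriv K (a e) (b e) p) = 0 := by
  have h : aeval (fun i => phiDual K e (vertexSum K (insert e S) a b i)) p = 0 := by
    rw [← MvPolynomial.comp_aeval_apply, hp, map_zero]
  simp only [phiDual_vertexSum he, aeval_dualNumber] at h
  constructor
  · simpa using congrArg TrivSqZeroExt.fst h
  · simpa using congrArg TrivSqZeroExt.snd h

end DualNumbers

section Antiderivative

/-- Every polynomial is a combination of powers of a slice `w` with coefficients killed by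
the derivation. -/
lemma mem_span_mul_pow {a b : V} {w : MvPolynomial V K}
    {c : K} (hc : c ≠ 0) (hw : edgeDeriv K a b w = C c) (p : MvPolynomial V K) :
    p ∈ Submodule.span K {q | ∃ s j, edgeDeriv K a b s = 0 ∧ q = s * w ^ j} := by
  induction p using MvPolynomial.induction_on with
  | C r => exact Submodule.subset_span ⟨C r, 0, by simp [edgeDeriv], by simp⟩
  | add p q hp hq => exact add_mem hp hq
  | mul_X p i hp =>
    induction hp using Submodule.span_induction with
    | zero => simp
    | add p q _ _ hp hq => rw [add_mul]; exact add_mem hp hq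
    | smul r p _ hp => rw [smul_mul_assoc]; exact Submodule.smul_mem _ _ hp
    | mem p hp =>
      obtain ⟨s, j, hs, rfl⟩ := hp
      set d : K := c⁻¹ * incidence a b i with hd
      have hz : edgeDeriv K a b (X i - C d * w) = 0 := by
        have hcd : d * c = incidence a b i := by rw [hd]; field_simp
        rw [map_sub, edgeDeriv_X, ← smul_eq_C_mul, Derivation.map_smul, hw, smul_eq_C_mul,
          ← C_mul, hcd]
        simp
      have hX : s * w ^ j * X i = s * (X i - C d * w) * w ^ j + d • (s * w ^ (j + 1)) := by
        rw [smul_eq_C_mul]; ring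
      rw [hX]
      refine add_mem (Submodule.subset_span ⟨_, j, ?_, rfl⟩)
        (Submodule.smul_mem _ _ (Submodule.subset_span ⟨s, j + 1, hs, rfl⟩))
      rw [Derivation.leibniz, hz, hs]
      simp

lemma exists_edgeDeriv_pow_mul [CharZero K] {a b : V} {w : MvPolynomial V K} {c : K}
    (hc : c ≠ 0) (hw : edgeDeriv K a b w = C c) (k : ℕ) (p : MvPolynomial V K) :
    ∃ q, edgeDeriv K a b (w ^ (k + 1) * q) = w ^ k * p := by
  induction mem_span_mul_pow hc hw p using Submodule.span_induction with
  | zero => exact ⟨0, by simp⟩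
  | add p q _ _ hp hq =>
    obtain ⟨p', hp'⟩ := hp
    obtain ⟨q', hq'⟩ := hq
    exact ⟨p' + q', by rw [mul_add, map_add, hp', hq', mul_add]⟩
  | smul r p _ hp =>
    obtain ⟨p', hp'⟩ := hp
    exact ⟨r • p', by rw [mul_smul_comm, Derivation.map_smul, hp', mul_smul_comm]⟩
  | mem p hp =>
    obtain ⟨s, j, hs, rfl⟩ := hp
    have hN : ((k + j + 1 : ℕ) : K) ≠ 0 := Nat.cast_ne_zero.2 (by omega)
    refine ⟨C (((k + j + 1 : ℕ) : K)⁻¹ * c⁻¹) * (s * w ^ j), ?_⟩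
    have h1 : w ^ (k + 1) * (C (((k + j + 1 : ℕ) : K)⁻¹ * c⁻¹) * (s * w ^ j)) =
        (((k + j + 1 : ℕ) : K)⁻¹ * c⁻¹) • (s * w ^ (k + j + 1)) := by
      rw [smul_eq_C_mul]; ring
    rw [h1, Derivation.map_smul, Derivation.leibniz, hs, Derivation.leibniz_pow, hw]
    have h2 : C (((k + j + 1 : ℕ) : K)⁻¹ * c⁻¹) * (((k + j + 1 : ℕ) : MvPolynomial V K) * C c)
        = 1 := by
      rw [← map_natCast C, ← C_mul, ← C_mul, ← C_1]
      congr 1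
      field_simp
    simp only [smul_eq_mul, nsmul_eq_mul, smul_eq_C_mul, add_tsub_cancel_right, mul_zero,
      add_zero]
    linear_combination (s * w ^ k * w ^ j) * h2

end Antiderivative

section Contraction

/-- Relabel `b` as `a`. -/
def contract (a b i : V) : V := if i = b then a else i

/-- The substitution `x_a ↦ x_a + x_b`, `x_b ↦ 0` dual to the contraction of `b` into `a`. -/
noncomputable def contractHom (K : Type*) [Field K] [Fintype V] (a b : V) :
    MvPolynomial V K →ₐ[K] MvPolynomial V K :=
  aeval fun k => ∑ m with contract a b m = k, X m

/-- The homotopy `x ↦ x + T x_b (e_a - e_b)`. -/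
noncomputable def edgeFlow (K : Type*) [Field K] (a b : V) :
    MvPolynomial V K →ₐ[K] Polynomial (MvPolynomial V K) :=
  aeval fun i => Polynomial.C (X i) +
    Polynomial.C (algebraMap ℤ (MvPolynomial V K) (incidence a b i) * X b) * Polynomial.X

lemma derivative_edgeFlow (a b : V) (p : MvPolynomial V K) :
    Polynomial.derivative (edgeFlow K a b p) =
      Polynomial.C (X b) * edgeFlow K a b (edgeDeriv K a b p) := by
  induction p using MvPolynomial.induction_on with
  | C r =>
    rw [← algebraMap_eq, AlgHom.commutes, Derivation.map_algebraMap, map_zero, mul_zero,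
      Polynomial.algebraMap_apply, Polynomial.derivative_C]
  | add p q hp hq => simp only [map_add, hp, hq, mul_add]
  | mul_X p i hp =>
    rw [map_mul, Polynomial.derivative_mul, hp, Derivation.leibniz, edgeDeriv_X]
    simp [edgeFlow]
    ring

lemma eval_zero_edgeFlow (a b : V) (p : MvPolynomial V K) :
    (edgeFlow K a b p).eval 0 = p := by
  induction p using MvPolynomial.induction_on with
  | C r =>
    rw [← algebraMap_eq, AlgHom.commutes, Polynomial.algebraMap_apply, Polynomial.eval_C]
  | add p q hp hq => rw [map_add, Polynomial.eval_add, hp, hq]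
  | mul_X p i hp => rw [map_mul, Polynomial.eval_mul, hp]; simp [edgeFlow]

variable [Fintype V]

lemma contractHom_X {a b : V} (hab : a ≠ b) (i : V) :
    contractHom K a b (X i) =
      X i + algebraMap ℤ (MvPolynomial V K) (incidence a b i) * X b := by
  rw [contractHom, aeval_X]
  by_cases hb : i = b
  · subst hb
    have : (Finset.univ.filter fun m => contract a i m = i) = ∅ := by
      ext m; rw [Finset.mem_filter_univ, contract]; split_ifs <;> simp_all
    simp [this, incidence, hab.symm]
  · by_cases ha : i = a
    · subst ha
      have : (Finset.univ.filter fun m => contract i b m = i) = {i, b} := by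
        ext m; rw [Finset.mem_filter_univ, contract]; split_ifs <;> simp_all
      simp [this, incidence, hab]
    · have : (Finset.univ.filter fun m => contract a b m = i) = {i} := by
        ext m; rw [Finset.mem_filter_univ, contract]; split_ifs <;> simp_all [eq_comm]
      simp [this, incidence, ha, hb]

lemma eval_one_edgeFlow {a b : V} (hab : a ≠ b) (p : MvPolynomial V K) :
    (edgeFlow K a b p).eval 1 = contractHom K a b p := by
  induction p using MvPolynomial.induction_on with
  | C r =>
    rw [← algebraMap_eq, AlgHom.commutes, AlgHom.commutes, Polynomial.algebraMap_apply,
      Polynomial.eval_C]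
  | add p q hp hq => rw [map_add, Polynomial.eval_add, hp, hq, map_add]
  | mul_X p i hp =>
    rw [map_mul, Polynomial.eval_mul, hp, map_mul, contractHom_X hab]; simp [edgeFlow]

lemma contractHom_eq_self [CharZero K] {a b : V} (hab : a ≠ b) {p : MvPolynomial V K}
    (hp : edgeDeriv K a b p = 0) : contractHom K a b p = p := by
  have h := derivative_edgeFlow a b p
  rw [hp, map_zero, mul_zero] at h
  have hC := Polynomial.eq_C_of_natDegree_eq_zero
    (Polynomial.derivative_eq_zero.1 h)
  rw [← eval_one_edgeFlow hab]
  conv_rhs => rw [← eval_zero_edgeFlow a b p]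
  rw [hC, Polynomial.eval_C, Polynomial.eval_C]

lemma contractHom_sum_X (a b : V) (I : Finset V) :
    contractHom K a b (∑ i ∈ I, X i) = ∑ m with contract a b m ∈ I, X m := by
  simp only [contractHom, map_sum, aeval_X, Finset.sum_filter]
  rw [Finset.sum_comm]
  simp

lemma vertexSum_contract (S : Finset E) (a b : E → V) (u v i : V) :
    vertexSum K S (contract u v ∘ a) (contract u v ∘ b) i =
      ∑ m with contract u v m = i, vertexSum K S a b m := by
  rw [sum_vertexSum]
  simp [vertexSum, incidence, eq_comm]

lemma aeval_vertexSum_contract (S : Finset E) (a b : E → V) (u v : V)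
    (p : MvPolynomial V K) :
    aeval (vertexSum K S (contract u v ∘ a) (contract u v ∘ b)) p =
      aeval (vertexSum K S a b) (contractHom K u v p) := by
  rw [contractHom, MvPolynomial.comp_aeval_apply]
  congr 2
  ext i
  simp [vertexSum_contract]

lemma contractHom_mem_cutIdeal [DecidableEq E] {S : Finset E} {e : E} {a b : E → V}
    {p : MvPolynomial V K}
    (hp : p ∈ cutIdeal K S (contract (a e) (b e) ∘ a) (contract (a e) (b e) ∘ b)) :
    contractHom K (a e) (b e) p ∈ cutIdeal K (insert e S) a b := by
  suffices cutIdeal K S (contract (a e) (b e) ∘ a) (contract (a e) (b e) ∘ b) ≤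
      (cutIdeal K (insert e S) a b).comap (contractHom K (a e) (b e)) from this hp
  rw [cutIdeal, Ideal.span_le]
  rintro _ ⟨I, _, rfl⟩
  rw [SetLike.mem_coe, Ideal.mem_comap, map_pow, contractHom_sum_X]
  set I' : Finset V := Finset.univ.filter fun m => contract (a e) (b e) m ∈ I with hI'
  obtain h | h := I'.eq_empty_or_nonempty
  · simp [h]
  · have hcard : cutCard S (contract (a e) (b e) ∘ a) (contract (a e) (b e) ∘ b) I =
        cutCard (insert e S) a b I' := by
      rw [cutCard_insert_of_iff]
      · simp [cutCard, hI']
      · rw [hI', Finset.mem_filter_univ, Finset.mem_filter_univ]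
        simp [contract]
    rw [hcard]
    exact Ideal.subset_span ⟨I', h, rfl⟩

end Contraction

lemma exists_edgeDeriv_eq_of_mem_cutIdeal [CharZero K] [DecidableEq E] {S : Finset E} {e : E}
    (he : e ∉ S) {a b : E → V} (hab : a e ≠ b e) {q : MvPolynomial V K}
    (hq : q ∈ cutIdeal K S a b) :
    ∃ p ∈ cutIdeal K (insert e S) a b, edgeDeriv K (a e) (b e) p = q := by
  suffices h : ∀ r, ∃ p ∈ cutIdeal K (insert e S) a b, edgeDeriv K (a e) (b e) p = r * q by
    simpa using h 1
  induction hq using Submodule.span_induction with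
  | zero => exact fun r => ⟨0, zero_mem _, by simp⟩
  | add p q _ _ hp hq =>
    intro r
    obtain ⟨p', hp, hp'⟩ := hp r
    obtain ⟨q', hq, hq'⟩ := hq r
    exact ⟨p' + q', add_mem hp hq, by rw [map_add, hp', hq', mul_add]⟩
  | smul s p _ hp =>
    intro r
    obtain ⟨p', hp, hp'⟩ := hp (r * s)
    exact ⟨p', hp, by rw [hp', smul_eq_mul, mul_assoc]⟩
  | mem p hp =>
    obtain ⟨I, hI, rfl⟩ := hp
    intro r
    have hmem : (∑ i ∈ I, X i) ^ (cutCard (insert e S) a b I + 1) ∈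
        cutIdeal K (insert e S) a b := Ideal.subset_span ⟨I, hI, rfl⟩
    by_cases hcut : a e ∈ I ↔ b e ∈ I
    · rw [cutCard_insert_of_iff hcut] at hmem
      have hX : edgeDeriv K (a e) (b e) (X (a e)) = C 1 := by
        simp [edgeDeriv_X, incidence, hab]
      obtain ⟨Q, hQ⟩ := exists_edgeDeriv_pow_mul one_ne_zero hX 0 r
      refine ⟨_, Ideal.mul_mem_left _ (X (a e) ^ (0 + 1) * Q) hmem, ?_⟩
      rw [Derivation.leibniz, hQ, Derivation.leibniz_pow, edgeDeriv_sum_X]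
      simp [hcut, mul_comm]
    · rw [cutCard_insert_of_not he hcut] at hmem
      obtain ⟨c, hc, hw⟩ : ∃ c : K, c ≠ 0 ∧
          edgeDeriv K (a e) (b e) (∑ i ∈ I, X i) = C c := by
        refine ⟨(if a e ∈ I then 1 else 0) - (if b e ∈ I then 1 else 0), ?_, ?_⟩
        · by_cases h1 : a e ∈ I <;> by_cases h2 : b e ∈ I <;> simp_all
        · rw [edgeDeriv_sum_X]; split_ifs <;> simp
      obtain ⟨Q, hQ⟩ := exists_edgeDeriv_pow_mul hc hw (cutCard S a b I + 1) r
      exact ⟨_, Ideal.mul_mem_right Q _ hmem, by rw [hQ, mul_comm]⟩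

lemma cutIdeal_insert_of_eq [DecidableEq E] (S : Finset E) {e : E} {a b : E → V}
    (hab : a e = b e) : cutIdeal K (insert e S) a b = cutIdeal K S a b := by
  have h (I : Finset V) : cutCard (insert e S) a b I = cutCard S a b I :=
    cutCard_insert_of_iff (by rw [hab])
  simp only [cutIdeal, h]

lemma mem_cutIdeal_empty {a b : E → V} {p : MvPolynomial V K} (hp : constantCoeff p = 0) :
    p ∈ cutIdeal K (∅ : Finset E) a b := by
  have hle : Ideal.span (Set.range (X : V → MvPolynomial V K)) ≤ cutIdeal K ∅ a b := by
    rw [Ideal.span_le]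
    rintro _ ⟨i, rfl⟩
    exact Ideal.subset_span ⟨{i}, by simp, by simp [cutCard]⟩
  apply hle
  rw [← Set.image_univ, mem_ideal_span_X_image]
  intro m hm
  by_contra! h
  have : m = 0 := by ext i; simpa using h i
  subst this
  exact (mem_support_iff.1 hm) hp

theorem mem_cutIdeal_of_aeval_vertexSum_eq_zero [Fintype V] [CharZero K] (S : Finset E)
    (a b : E → V) (p : MvPolynomial V K) (hp : aeval (vertexSum K S a b) p = 0) :
    p ∈ cutIdeal K S a b := by
  classical
  induction S using Finset.induction_on generalizing a b p with
  | empty =>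
    have h0 : vertexSum K (∅ : Finset E) a b = 0 := by ext; simp [vertexSum]
    rw [h0, aeval_zero] at hp
    have : Nontrivial (Phi K E 1) := by
      refine Ideal.Quotient.nontrivial_iff.2 fun h => ?_
      have hle : phiIdeal K E 1 ≤ RingHom.ker (constantCoeff (σ := E) (R := K)) := by
        rw [phiIdeal, Ideal.span_le]
        rintro _ ⟨e, rfl⟩
        simp [RingHom.mem_ker]
      have h1 := hle (h ▸ Submodule.mem_top : (1 : MvPolynomial E K) ∈ _)
      simp [RingHom.mem_ker] at h1
    exact mem_cutIdeal_empty ((map_eq_zero_iff _ (algebraMap K (Phi K E 1)).injective).1 hp)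
  | insert e S he ih =>
    obtain ⟨hp0, hp1⟩ := aeval_vertexSum_insert_eq_zero he hp
    by_cases hab : a e = b e
    · rw [cutIdeal_insert_of_eq S hab]
      exact ih a b p hp0
    obtain ⟨q, hq, hqp⟩ := exists_edgeDeriv_eq_of_mem_cutIdeal he hab (ih a b _ hp1)
    have hq0 := (aeval_vertexSum_insert_eq_zero he (aeval_vertexSum_eq_zero_of_mem hq)).1
    have hr : contractHom K (a e) (b e) (p - q) = p - q :=
      contractHom_eq_self hab (by rw [map_sub, hqp, sub_self])
    have hmem : p - q ∈ cutIdeal K (insert e S) a b := by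
      rw [← hr]
      apply contractHom_mem_cutIdeal
      apply ih
      rw [aeval_vertexSum_contract, hr, map_sub, hp0, hq0, sub_zero]
    simpa using add_mem hmem hq

end CutIdeal

lemma crossCount_eq_cutCard {n : ℕ} {E : Type*} [Fintype E] (ends : E → Sym2 (Fin n))
    (I : Finset (Fin n)) :
    crossCount ends I =
      cutCard Finset.univ (fun e => symInf (ends e)) (fun e => symSup (ends e)) I := by
  rw [crossCount, cutCard, ← Set.ncard_coe_finset]
  congr 1
  ext e
  simp only [Set.mem_ofPred_eq, Finset.coe_filter, Finset.mem_univ, true_and]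
  induction ends e using Sym2.ind with
  | _ x y =>
    obtain h | h := le_total x y <;> simp [symInf, symSup, h] <;> tauto

lemma forestIdeal_eq_cutIdeal (K : Type*) [Field K] {n : ℕ} {E : Type*} [Fintype E]
    (ends : E → Sym2 (Fin n)) :
    forestIdeal K 1 ends =
      cutIdeal K Finset.univ (fun e => symInf (ends e)) (fun e => symSup (ends e)) := by
  simp only [forestIdeal, cutIdeal, one_mul, crossCount_eq_cutCard]

lemma ker_aeval_Xgen (K : Type*) [Field K] [CharZero K] {n : ℕ} {E : Type*} [Fintype E]
    (ends : E → Sym2 (Fin n)) :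
    RingHom.ker (aeval (Xgen K 1 ends) : MvPolynomial (Fin n) K →ₐ[K] Phi K E 1) =
      forestIdeal K 1 ends := by
  rw [forestIdeal_eq_cutIdeal]
  ext p
  exact ⟨mem_cutIdeal_of_aeval_vertexSum_eq_zero _ _ _ p, aeval_vertexSum_eq_zero_of_mem⟩

/-- For a finite multigraph `G` and a field `K` of
characteristic `0`, the algebras `B_G^{F_1}` and `C_G^{F_1}` are isomorphic as
`K`-algebras. -/
theorem B_iso_C_F1 {n : ℕ} {E : Type} [Fintype E] (ends : E → Sym2 (Fin n))
    (K : Type) [Field K] [CharZero K] :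
    Nonempty ((MvPolynomial (Fin n) K ⧸ forestIdeal K 1 ends) ≃ₐ[K]
      Csub K 1 ends) := by
  rw [← ker_aeval_Xgen, Csub, Algebra.adjoin_range_eq_range_aeval]
  exact ⟨Ideal.quotientKerEquivRange _⟩

end ForestAlg
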